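/- arXiv:1207.2189 — 6 statements merged into one kernel-verified Lean document; each statement's English description precedes it below -/
import Mathlib

section
/- Let r_1, r_2, …, r_n (n ≥ 1) be a list of rows, each a c-tuple. Then the total number of runs of the ordered table equals c + Σ_{i=1}^{n−1} d(r_i, r_{i+1}), where d is the Hamming distance. -/
/-- Number of runs in a column, given as a list of values: the number of
positions that start a new run. -/
def runs {V : Type*} [DecidableEq V] : List V → ℕ
  | [] => 0
  | [_] => 1
  | a :: b :: rest => (if a = b then 0 else 1) + runs (b :: rest)

/-- The `RunCount` of an ordered table: total number of runs over all columns. -/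
def runCount {c : ℕ} {V : Type*} [DecidableEq V] (t : List (Fin c → V)) : ℕ :=
  ∑ j : Fin c, runs (t.map fun r => r j)

/-- The RunCount of a nonempty ordered table equals `c` plus the sum of
Hamming distances between successive rows. -/
theorem stmt0 {c : ℕ} {V : Type*} [DecidableEq V] (t : List (Fin c → V)) (ht : t ≠ []) :
    runCount t = c + (List.zipWith hammingDist t t.tail).sum := by
  induction t with
  | nil => exact absurd rfl ht
  | cons a l ih =>
    cases l with
    | nil => simp [runCount, runs]
    | cons b l =>
      have h := ih (List.cons_ne_nil b l)
      have hd : hammingDist a b = ∑ j, if a j = b j then 0 else 1 := by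
        simp only [hammingDist, Finset.card_filter, ne_eq, ite_not]
      simp only [runCount, List.map_cons, runs, Finset.sum_add_distrib, List.tail_cons,
        List.zipWith_cons_cons, List.sum_cons] at h ⊢
      rw [h, hd]
      ring
end

section
/- For any ordering of the rows of a table with c ≥ 1 columns containing n ≥ 1 distinct rows, the RunCount is at least n + c − 1. -/
theorem runCount_singleton {c : ℕ} {V : Type*} [DecidableEq V] (r : Fin c → V) :
    runCount [r] = c := by
  simp [runCount, runs]

/-- Prepending a row adds one run for each column in which it differs from the next row. -/
theorem runCount_cons_cons {c : ℕ} {V : Type*} [DecidableEq V] (r s : Fin c → V)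
    (t : List (Fin c → V)) :
    runCount (r :: s :: t) = (∑ j, if r j = s j then 0 else 1) + runCount (s :: t) := by
  simp [runCount, runs, Finset.sum_add_distrib]

theorem one_le_sum_ite_of_ne {ι V : Type*} [Fintype ι] [DecidableEq V] {r s : ι → V}
    (h : r ≠ s) : 1 ≤ ∑ j, if r j = s j then 0 else 1 := by
  obtain ⟨j, hj⟩ := Function.ne_iff.mp h
  calc 1 = if r j = s j then 0 else 1 := (if_neg hj).symm
    _ ≤ _ := Finset.single_le_sum (f := fun j => if r j = s j then 0 else 1)
      (fun _ _ => Nat.zero_le _) (Finset.mem_univ j)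

theorem card_toFinset_add_le_runCount_add_one {c : ℕ} {V : Type*} [DecidableEq V]
    (r : Fin c → V) (t : List (Fin c → V)) :
    (r :: t).toFinset.card + c ≤ runCount (r :: t) + 1 := by
  induction t generalizing r with
  | nil => simp [runCount_singleton, add_comm]
  | cons s t ih =>
    have hs := ih s
    rw [runCount_cons_cons]
    by_cases h : r = s
    · subst h
      have : (r :: r :: t).toFinset = (r :: t).toFinset := by simp
      rw [this]
      omega
    · have hsum := one_le_sum_ite_of_ne h
      have hcard : (r :: s :: t).toFinset.card ≤ (s :: t).toFinset.card + 1 := by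
        rw [List.toFinset_cons (a := r)]
        exact Finset.card_insert_le _ _
      omega

/-- For any ordering of a table with `c ≥ 1` columns and `n ≥ 1` distinct rows,
the RunCount is at least `n + c - 1`. -/
theorem stmt1 {c : ℕ} {V : Type*} [DecidableEq V] (hc : 1 ≤ c)
    (t : List (Fin c → V)) (ht : t ≠ []) :
    t.toFinset.card + c - 1 ≤ runCount t := by
  obtain ⟨r, t, rfl⟩ := List.exists_cons_of_ne_nil ht
  have := card_toFinset_add_le_runCount_add_one r t
  omega
end

section
/- Consider the table whose rows are exactly all tuples of {1,…,N_1} × {1,…,N_2} × ⋯ × {1,…,N_c} (each appearing once), where every N_k ≥ 1. There exists an ordering of the rows whose RunCount equals N_1 N_2 ⋯ N_c + c − 1. -/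
theorem runCount_cons_cons_s6 {c : ℕ} {V : Type*} [DecidableEq V] (a b : Fin c → V)
    (l : List (Fin c → V)) :
    runCount (a :: b :: l) = hammingDist a b + runCount (b :: l) := by
  have h : ∑ j : Fin c, (if a j = b j then 0 else 1) = hammingDist a b := by
    simp only [hammingDist, Finset.card_filter, ne_eq, ite_not]
  rw [← h]
  simp only [runCount, List.map_cons, runs, Finset.sum_add_distrib]

theorem runCount_cons_of_isChain {c : ℕ} {V : Type*} [DecidableEq V] (a : Fin c → V)
    (l : List (Fin c → V)) (h : (a :: l).IsChain fun x y => hammingDist x y = 1) :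
    runCount (a :: l) = l.length + c := by
  induction l generalizing a with
  | nil => simp [runCount, runs]
  | cons b l ih =>
    rw [List.isChain_cons_cons] at h
    rw [runCount_cons_cons_s6, h.1, ih b h.2, List.length_cons]
    omega

theorem hammingDist_snoc {c : ℕ} {V : Type*} [DecidableEq V] (a b : Fin c → V) (v w : V) :
    hammingDist (Fin.snoc a v : Fin (c + 1) → V) (Fin.snoc b w) =
      hammingDist a b + if v = w then 0 else 1 := by
  simp only [hammingDist, Finset.card_filter, ne_eq, ite_not, Fin.sum_univ_castSucc,
    Fin.snoc_castSucc, Fin.snoc_last]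

/-- The boustrophedon product: copies of `t`, alternately reversed, extended by a last
coordinate that descends from `n` to `1`. -/
def boustrophedon {c : ℕ} : ℕ → List (Fin c → ℕ) → List (Fin (c + 1) → ℕ)
  | 0, _ => []
  | n + 1, t => t.map (fun a => Fin.snoc a (n + 1)) ++ boustrophedon n t.reverse

theorem mem_boustrophedon {c n : ℕ} {t : List (Fin c → ℕ)} {r : Fin (c + 1) → ℕ} :
    r ∈ boustrophedon n t ↔ Fin.init r ∈ t ∧ 1 ≤ r (Fin.last c) ∧ r (Fin.last c) ≤ n := by
  induction n generalizing t with
  | zero => simp only [boustrophedon, List.not_mem_nil, false_iff]; omega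
  | succ n ih =>
    rw [boustrophedon, List.mem_append, ih, List.mem_reverse, List.mem_map]
    constructor
    · rintro (⟨a, ha, rfl⟩ | ⟨h, h1, h2⟩)
      · simp [ha]
      · exact ⟨h, h1, by omega⟩
    · rintro ⟨h, h1, h2⟩
      by_cases hn : r (Fin.last c) = n + 1
      · exact Or.inl ⟨_, h, by rw [← hn, Fin.snoc_init_self]⟩
      · exact Or.inr ⟨h, h1, by omega⟩

theorem nodup_boustrophedon {c n : ℕ} {t : List (Fin c → ℕ)} (ht : t.Nodup) :
    (boustrophedon n t).Nodup := by
  induction n generalizing t with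
  | zero => exact List.nodup_nil
  | succ n ih =>
    rw [boustrophedon, List.nodup_append]
    refine ⟨ht.map fun a b h => ?_, ih (List.nodup_reverse.2 ht), ?_⟩
    · simpa using congrArg Fin.init h
    · rintro x hx y hy rfl
      obtain ⟨a, -, rfl⟩ := List.mem_map.1 hx
      have := (mem_boustrophedon.1 hy).2.2
      simp at this

theorem head?_boustrophedon {c n : ℕ} {t : List (Fin c → ℕ)} {x : Fin (c + 1) → ℕ}
    (ht : t ≠ []) (hx : x ∈ (boustrophedon n t).head?) :
    ∃ a ∈ t.head?, x = Fin.snoc a n := by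
  cases n with
  | zero => simp [boustrophedon] at hx
  | succ n =>
    obtain ⟨a, l, rfl⟩ := List.exists_cons_of_ne_nil ht
    simp only [boustrophedon, List.map_cons, List.cons_append, List.head?_cons,
      Option.mem_some_iff] at hx
    exact ⟨a, rfl, hx.symm⟩

theorem isChain_boustrophedon {c n : ℕ} {t : List (Fin c → ℕ)} (hne : t ≠ [])
    (ht : t.IsChain fun x y => hammingDist x y = 1) :
    (boustrophedon n t).IsChain fun x y => hammingDist x y = 1 := by
  induction n generalizing t with
  | zero => exact List.isChain_nil
  | succ n ih =>
    have hne' : t.reverse ≠ [] := by simpa using hne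
    rw [boustrophedon, List.isChain_append]
    refine ⟨?_, ih hne' ?_, ?_⟩
    · rw [List.isChain_map]
      simpa [hammingDist_snoc] using ht
    · rw [List.isChain_reverse]
      simpa only [hammingDist_comm, flip] using ht
    · intro x hx y hy
      obtain ⟨b, hb, rfl⟩ := head?_boustrophedon hne' hy
      rw [List.getLast?_map, Option.mem_def, Option.map_eq_some_iff] at hx
      obtain ⟨a, ha, rfl⟩ := hx
      rw [List.head?_reverse, Option.mem_def, ha, Option.some_inj] at hb
      simp [hammingDist_snoc, hb]

/-- Gray codes: a box of tuples can be listed so that consecutive tuples differ in exactly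
one coordinate. -/
theorem exists_gray_code (N : ℕ → ℕ) (c : ℕ) (hN : ∀ k < c, 1 ≤ N k) :
    ∃ t : List (Fin c → ℕ), t.Nodup ∧
      (∀ r : Fin c → ℕ, r ∈ t ↔ ∀ k : Fin c, 1 ≤ r k ∧ r k ≤ N k.1) ∧
      t.IsChain fun x y => hammingDist x y = 1 := by
  induction c with
  | zero =>
    refine ⟨[Fin.elim0], List.nodup_singleton _, fun r => ?_, List.isChain_singleton _⟩
    simpa using Subsingleton.elim _ _
  | succ c ih =>
    obtain ⟨t, hnd, hmem, hch⟩ := ih fun k hk => hN k (by omega)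
    have hne : t ≠ [] :=
      List.ne_nil_of_mem ((hmem fun _ => 1).2 fun k => ⟨le_rfl, hN k (by omega)⟩)
    refine ⟨boustrophedon (N c) t, nodup_boustrophedon hnd, fun r => ?_,
      isChain_boustrophedon hne hch⟩
    rw [mem_boustrophedon, hmem, Fin.forall_fin_succ']
    rfl

/-- For the table whose rows are exactly all tuples of
`{1,…,N 0} × ⋯ × {1,…,N (c-1)}` (each appearing once), there exists an ordering
of the rows whose RunCount equals `N_1 N_2 ⋯ N_c + c - 1`. -/
theorem stmt6 {c : ℕ} (N : ℕ → ℕ) (hN : ∀ k < c, 1 ≤ N k) :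
    ∃ t : List (Fin c → ℕ), t.Nodup ∧
      (∀ r : Fin c → ℕ, r ∈ t ↔ ∀ k : Fin c, 1 ≤ r k ∧ r k ≤ N k.1) ∧
      runCount t = (∏ k ∈ Finset.range c, N k) + c - 1 := by
  obtain ⟨t, hnd, hmem, hch⟩ := exists_gray_code N c hN
  refine ⟨t, hnd, hmem, ?_⟩
  have hlen : t.length = ∏ k ∈ Finset.range c, N k := by
    have h : t.toFinset = Fintype.piFinset fun k : Fin c => Finset.Icc 1 (N k) := by
      ext r
      simp [hmem]
    rw [← List.toFinset_card_of_nodup hnd, h, Fintype.card_piFinset, Finset.prod_range]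
    simp
  have hne : t ≠ [] :=
    List.ne_nil_of_mem ((hmem fun _ => 1).2 fun k => ⟨le_rfl, hN k k.2⟩)
  obtain ⟨a, l, rfl⟩ := List.exists_cons_of_ne_nil hne
  rw [runCount_cons_of_isChain a l hch, ← hlen, List.length_cons]
  omega
end

section
/- Any discriminating ordering of the rows of a table with c ≥ 1 columns is c-optimal for the RunCount minimization problem: if a table with n distinct rows is ordered so that identical rows appear consecutively, then its RunCount is at most n·c, while every ordering of the table has RunCount at least n; consequently the RunCount of any discriminating ordering is at most c times the RunCount of any other ordering. -/
/-- An ordering of the rows is *discriminating* if identical (duplicate) rows are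
listed consecutively: for every row `r` of the table, all occurrences of `r` form
one contiguous block. -/
def Discriminating {c : ℕ} {V : Type*} [DecidableEq V] (t : List (Fin c → V)) : Prop :=
  ∀ r ∈ t, ∃ (n : ℕ) (l₁ l₂ : List (Fin c → V)),
    t = l₁ ++ List.replicate n r ++ l₂ ∧ r ∉ l₁ ∧ r ∉ l₂

lemma runs_map_le {α β : Type*} [DecidableEq α] [DecidableEq β] (f : α → β) (l : List α) :
    runs (l.map f) ≤ runs l := by
  induction l using runs.induct with
  | case1 => simp [runs]
  | case2 a => simp [runs]
  | case3 a b l ih =>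
    simp only [List.map_cons, runs] at ih ⊢
    have : (if f a = f b then 0 else 1) ≤ (if a = b then 0 else 1) := by
      by_cases h : a = b
      · simp [h]
      · rw [if_neg h]
        split_ifs <;> simp
    lia

lemma card_toFinset_le_runs {α : Type*} [DecidableEq α] (l : List α) :
    l.toFinset.card ≤ runs l := by
  induction l using runs.induct with
  | case1 => simp [runs]
  | case2 a => simp [runs]
  | case3 a b l ih =>
    rw [List.toFinset_cons, runs]
    by_cases h : a = b
    · rw [Finset.insert_eq_of_mem (by simp [h])]
      lia
    · have := Finset.card_insert_le a (b :: l).toFinset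
      rw [if_neg h]
      lia

lemma runs_le_runCount {c : ℕ} {V : Type*} [DecidableEq V] (hc : 1 ≤ c)
    (t : List (Fin c → V)) : runs t ≤ runCount t := by
  induction t using runs.induct with
  | case1 => simp [runs]
  | case2 a => simpa [runs, runCount] using hc
  | case3 a b l ih =>
    simp only [runCount, List.map_cons, runs, Finset.sum_add_distrib] at ih ⊢
    refine Nat.add_le_add ?_ ih
    split_ifs with h
    · simp
    · obtain ⟨j, hj⟩ := Function.ne_iff.mp h
      calc 1 = (if a j = b j then 0 else 1) := by rw [if_neg hj]
        _ ≤ ∑ i : Fin c, (if a i = b i then 0 else 1) :=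
          Finset.single_le_sum (f := fun i => if a i = b i then 0 else 1)
            (fun _ _ => Nat.zero_le _) (Finset.mem_univ j)

lemma Discriminating.tail {c : ℕ} {V : Type*} [DecidableEq V] {a : Fin c → V}
    {t : List (Fin c → V)} (h : Discriminating (a :: t)) : Discriminating t := by
  intro r hr
  obtain ⟨n, l₁, l₂, ht, h₁, h₂⟩ := h r (List.mem_cons_of_mem a hr)
  cases l₁ with
  | nil =>
    cases n with
    | zero =>
      simp only [List.replicate_zero, List.nil_append] at ht
      exact absurd (ht ▸ List.mem_cons_of_mem a hr) h₂
    | succ m =>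
      simp only [List.replicate_succ, List.nil_append, List.cons_append, List.cons.injEq] at ht
      exact ⟨m, [], l₂, by simpa using ht.2, by simp, h₂⟩
  | cons x l₁ =>
    simp only [List.cons_append, List.cons.injEq] at ht
    exact ⟨n, l₁, l₂, ht.2, fun h => h₁ (List.mem_cons_of_mem x h), h₂⟩

lemma Discriminating.notMem_of_ne {c : ℕ} {V : Type*} [DecidableEq V] {a b : Fin c → V}
    {t : List (Fin c → V)} (h : Discriminating (a :: b :: t)) (hab : a ≠ b) :
    a ∉ b :: t := by
  obtain ⟨n, l₁, l₂, ht, h₁, h₂⟩ := h a List.mem_cons_self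
  cases l₁ with
  | nil =>
    match n with
    | 0 =>
      simp only [List.replicate_zero, List.nil_append] at ht
      exact absurd (ht ▸ List.mem_cons_self) h₂
    | 1 => simp_all
    | m + 2 =>
      simp only [List.replicate_succ, List.nil_append, List.cons_append, List.cons.injEq] at ht
      exact absurd ht.2.1.symm hab
  | cons x l₁ =>
    simp only [List.cons_append, List.cons.injEq] at ht
    exact absurd (ht.1 ▸ List.mem_cons_self) h₁

lemma Discriminating.runs_le_card {c : ℕ} {V : Type*} [DecidableEq V]
    {t : List (Fin c → V)} (h : Discriminating t) : runs t ≤ t.toFinset.card := by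
  induction t using runs.induct with
  | case1 => simp [runs]
  | case2 a => simp [runs]
  | case3 a b l ih =>
    have ih := ih h.tail
    rw [List.toFinset_cons, runs]
    by_cases hab : a = b
    · rw [Finset.insert_eq_of_mem (by simp [hab]), if_pos hab]
      lia
    · rw [Finset.card_insert_of_notMem (by simpa using h.notMem_of_ne hab), if_neg hab]
      lia

/-- Any discriminating ordering of a table with `c ≥ 1` columns is `c`-optimal for
RunCount minimization: its RunCount is at most `n * c` (where `n` is the number of
distinct rows), every ordering has RunCount at least `n`, and consequently the
RunCount of the discriminating ordering is at most `c` times the RunCount of any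
other ordering. -/
theorem stmt8 {c : ℕ} {V : Type*} [DecidableEq V] (hc : 1 ≤ c)
    (t t' : List (Fin c → V)) (hd : Discriminating t) (hp : t'.Perm t) :
    runCount t ≤ t.toFinset.card * c ∧
    t'.toFinset.card ≤ runCount t' ∧
    runCount t ≤ c * runCount t' := by
  have hle : runCount t ≤ t.toFinset.card * c :=
    calc runCount t ≤ ∑ _j : Fin c, runs t :=
          Finset.sum_le_sum fun j _ => runs_map_le (fun r => r j) t
      _ = runs t * c := by simp [mul_comm]
      _ ≤ t.toFinset.card * c := Nat.mul_le_mul_right c hd.runs_le_card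
  have hge : t'.toFinset.card ≤ runCount t' :=
    (card_toFinset_le_runs t').trans (runs_le_runCount hc t')
  refine ⟨hle, hge, hle.trans ?_⟩
  rw [← List.toFinset_eq_of_perm _ _ hp, mul_comm]
  exact Nat.mul_le_mul_left c hge
end

section
/- For any finite multiset of c-tuples, there exists a discriminating ordering r_1, …, r_n of its elements that minimizes Σ_{i=1}^{n−1} d(r_i, r_{i+1}) over all orderings, where d is the Hamming distance. Moreover, from any ordering one can obtain a discriminating ordering whose cost Σ_{i=1}^{n−1} d(r_i, r_{i+1}) is less than or equal to that of the original ordering. -/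
/-- The cost of an ordering: the sum of Hamming distances between successive tuples. -/
def pathCost {c : ℕ} {V : Type*} [DecidableEq V] (t : List (Fin c → V)) : ℕ :=
  (List.zipWith hammingDist t t.tail).sum

theorem pathCost_cons_cons {c : ℕ} {V : Type*} [DecidableEq V] (a b : Fin c → V)
    (l : List (Fin c → V)) :
    pathCost (a :: b :: l) = hammingDist a b + pathCost (b :: l) := by
  simp [pathCost]

theorem pathCost_le_pathCost_cons {c : ℕ} {V : Type*} [DecidableEq V] (a : Fin c → V)
    (l : List (Fin c → V)) : pathCost l ≤ pathCost (a :: l) := by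
  cases l with
  | nil => simp [pathCost]
  | cons b l => rw [pathCost_cons_cons]; exact Nat.le_add_left _ _

theorem pathCost_cons_le_hammingDist_add {c : ℕ} {V : Type*} [DecidableEq V]
    (a b : Fin c → V) (l : List (Fin c → V)) :
    pathCost (a :: l) ≤ hammingDist a b + pathCost (b :: l) := by
  cases l with
  | nil => simp [pathCost]
  | cons x l =>
    rw [pathCost_cons_cons, pathCost_cons_cons]
    have := hammingDist_triangle a b x
    omega

theorem pathCost_cons_le_of_sublist {c : ℕ} {V : Type*} [DecidableEq V]
    {l₁ l₂ : List (Fin c → V)} (h : l₁.Sublist l₂) (a : Fin c → V) :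
    pathCost (a :: l₁) ≤ pathCost (a :: l₂) := by
  induction h generalizing a with
  | slnil => exact le_rfl
  | cons b _ ih =>
    rw [pathCost_cons_cons]
    exact (pathCost_cons_le_hammingDist_add a b _).trans (Nat.add_le_add_left (ih b) _)
  | cons_cons b _ ih =>
    rw [pathCost_cons_cons, pathCost_cons_cons]
    exact Nat.add_le_add_left (ih b) _

theorem pathCost_cons_replicate_append {c : ℕ} {V : Type*} [DecidableEq V] (a : Fin c → V)
    (n : ℕ) (l : List (Fin c → V)) :
    pathCost (a :: (List.replicate n a ++ l)) = pathCost (a :: l) := by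
  induction n with
  | zero => simp
  | succ n ih =>
    rw [List.replicate_succ, List.cons_append, pathCost_cons_cons, ih, hammingDist_self,
      zero_add]

theorem Discriminating.replicate_append {c : ℕ} {V : Type*} [DecidableEq V]
    {l : List (Fin c → V)} (hl : Discriminating l) {a : Fin c → V} (ha : a ∉ l) (n : ℕ) :
    Discriminating (List.replicate n a ++ l) := by
  intro r hr
  by_cases hra : r = a
  · subst hra
    exact ⟨n, [], l, by simp, by simp, ha⟩
  · have hrl : r ∈ l := by
      rcases List.mem_append.1 hr with h | h
      · exact absurd (List.eq_of_mem_replicate h) hra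
      · exact h
    obtain ⟨m, l₁, l₂, rfl, h₁, h₂⟩ := hl r hrl
    refine ⟨m, List.replicate n a ++ l₁, l₂, by simp, ?_, h₂⟩
    intro h
    rcases List.mem_append.1 h with h | h
    · exact hra (List.eq_of_mem_replicate h)
    · exact h₁ h

/-- Moving all duplicates up to their first occurrence does not increase the cost, even when
the ordering is preceded by an arbitrary tuple. -/
theorem exists_perm_discriminating_pathCost_cons_le {c : ℕ} {V : Type*} [DecidableEq V]
    (l : List (Fin c → V)) :
    ∃ t : List (Fin c → V), t.Perm l ∧ Discriminating t ∧
      ∀ b, pathCost (b :: t) ≤ pathCost (b :: l) := by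
  induction hn : l.length using Nat.strong_induction_on generalizing l with
  | _ n ih =>
  cases l with
  | nil => exact ⟨[], List.Perm.refl _, by simp [Discriminating], fun b => le_rfl⟩
  | cons a l =>
    obtain ⟨t, hperm, hdisc, hcost⟩ := ih (l.filter (fun x => !(x == a))).length
      (by have := List.length_filter_le (fun x => !(x == a)) l
          simp only [List.length_cons] at hn; omega) _ rfl
    have hat : a ∉ t := by simp [hperm.mem_iff]
    refine ⟨List.replicate (l.count a + 1) a ++ t, ?_, hdisc.replicate_append hat _, ?_⟩
    · rw [List.replicate_succ, List.cons_append, ← List.filter_beq]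
      exact ((hperm.append_left _).trans (List.filter_append_perm (fun x => x == a) l)).cons a
    · intro b
      rw [List.replicate_succ, List.cons_append, pathCost_cons_cons, pathCost_cons_cons,
        pathCost_cons_replicate_append]
      exact Nat.add_le_add_left
        ((hcost a).trans (pathCost_cons_le_of_sublist List.filter_sublist a)) _

theorem exists_perm_discriminating_pathCost_le {c : ℕ} {V : Type*} [DecidableEq V]
    (l : List (Fin c → V)) :
    ∃ t : List (Fin c → V), t.Perm l ∧ Discriminating t ∧ pathCost t ≤ pathCost l := by
  obtain ⟨t, hperm, hdisc, hcost⟩ := exists_perm_discriminating_pathCost_cons_le l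
  refine ⟨t, hperm, hdisc, ?_⟩
  cases l with
  | nil => rw [hperm.eq_nil]
  | cons a l =>
    refine (pathCost_le_pathCost_cons a t).trans ((hcost a).trans ?_)
    rw [pathCost_cons_cons, hammingDist_self, zero_add]

/-- For any finite multiset of `c`-tuples there is a discriminating ordering
minimizing the sum of Hamming distances between successive tuples; moreover, from
any ordering one can obtain a discriminating ordering of cost at most that of the
original ordering. -/
theorem stmt9 {c : ℕ} {V : Type*} [DecidableEq V] (s : Multiset (Fin c → V)) :
    (∃ t : List (Fin c → V), (t : Multiset (Fin c → V)) = s ∧ Discriminating t ∧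
      ∀ t' : List (Fin c → V), (t' : Multiset (Fin c → V)) = s → pathCost t ≤ pathCost t') ∧
    (∀ t' : List (Fin c → V), (t' : Multiset (Fin c → V)) = s →
      ∃ t : List (Fin c → V), (t : Multiset (Fin c → V)) = s ∧ Discriminating t ∧
        pathCost t ≤ pathCost t') := by
  have improve : ∀ t' : List (Fin c → V), (t' : Multiset (Fin c → V)) = s →
      ∃ t : List (Fin c → V), (t : Multiset (Fin c → V)) = s ∧ Discriminating t ∧
        pathCost t ≤ pathCost t' := by
    intro t' ht'
    obtain ⟨t, hperm, hdisc, hcost⟩ := exists_perm_discriminating_pathCost_le t'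
    exact ⟨t, (Multiset.coe_eq_coe.2 hperm).trans ht', hdisc, hcost⟩
  refine ⟨?_, improve⟩
  obtain ⟨m, hm, hmin⟩ := (measure (pathCost (c := c) (V := V))).wf.has_min
    {t | (t : Multiset (Fin c → V)) = s} (Quot.exists_rep s)
  obtain ⟨t, ht, hdisc, hcost⟩ := improve m hm
  exact ⟨t, ht, hdisc, fun t' ht' => hcost.trans (not_lt.1 (hmin t' ht'))⟩
end

section
/- Consider c-tuples with positive integer values. For any 1 ≤ k ≤ c, if τ is a c-tuple containing the value 1 in at least one of its first k components, and τ' is a c-tuple that does not contain the value 1 in any of its first k components, then τ <_VORTEX τ'. -/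
/-- `T(x)`: the list of pairs `(x_1,1), (x_2,2), …, (x_c,c)`, where pairs are
compared lexicographically (first by value, then by index). -/
def Tlist {c : ℕ} (x : Fin c → ℕ) : List (ℕ ×ₗ ℕ) :=
  List.ofFn fun i => toLex (x i, i.1 + 1)

/-- `T'(x)`: the list `T(x)` sorted lexicographically. -/
def Tsorted {c : ℕ} (x : Fin c → ℕ) : List (ℕ ×ₗ ℕ) :=
  List.insertionSort (· ≤ ·) (Tlist x)

/-- Auxiliary comparison for the alternating lexicographic order.  The Boolean
argument records whether the current (1-based) position is odd; at the first
position where the two lists differ, the comparison is by `<` at odd positions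
and by the reversed `<` at even positions. -/
def altB {α : Type*} [LinearOrder α] : Bool → List α → List α → Bool
  | _, [], _ => false
  | _, _ :: _, [] => false
  | oddPos, a :: as, b :: bs =>
      if a = b then altB (!oddPos) as bs
      else if oddPos then decide (a < b) else decide (b < a)

/-- The alternating lexicographic order `<_ALT`: if `j` is the first position where
the lists differ (positions numbered from 1), then `a <_ALT b` iff
`(a_j < b_j) XOR (j is even)`. -/
def altLt {α : Type*} [LinearOrder α] (a b : List α) : Prop := altB true a b = true

/-- The Vortex order: `x <_VORTEX y` iff `T'(x) <_ALT T'(y)`. -/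
def vortexLt {c : ℕ} (x y : Fin c → ℕ) : Prop := altLt (Tsorted x) (Tsorted y)

/-- The non-strict Vortex order. -/
def vortexLe {c : ℕ} (x y : Fin c → ℕ) : Prop := vortexLt x y ∨ x = y

instance {c : ℕ} : DecidableRel (@vortexLe c) := fun x y => by
  unfold vortexLe vortexLt altLt; infer_instance

/-- `VORTEX(N_1,…,N_c)`: the list of all tuples of `{1,…,N_1} × ⋯ × {1,…,N_c}`
sorted in increasing Vortex order. -/
noncomputable def vortexList {c : ℕ} (Ns : Fin c → ℕ) : List (Fin c → ℕ) :=
  List.insertionSort vortexLe (Fintype.piFinset fun i => Finset.Icc 1 (Ns i)).toList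

/-- `Λ_{c,k}^N`: `VORTEX(N,…,N,N-1,…,N-1)` with `c-k` copies of `N` followed by
`k` copies of `N-1`. -/
noncomputable def Lam (c k N : ℕ) : List (Fin c → ℕ) :=
  vortexList fun i => if i.1 < c - k then N else N - 1

/-- A list of tuples is a Gray code if every pair of consecutive tuples has
Hamming distance exactly 1. -/
def IsGrayCode {c : ℕ} (l : List (Fin c → ℕ)) : Prop :=
  l.Chain' fun x y => hammingDist x y = 1

theorem Tsorted_pairwise {c : ℕ} (x : Fin c → ℕ) : (Tsorted x).Pairwise (· ≤ ·) :=
  List.pairwise_insertionSort _ _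

theorem mem_Tsorted {c : ℕ} {x : Fin c → ℕ} {p : ℕ ×ₗ ℕ} :
    p ∈ Tsorted x ↔ ∃ i, toLex (x i, i.1 + 1) = p := by
  rw [Tsorted, (List.perm_insertionSort _ _).mem_iff, Tlist, List.mem_ofFn]

theorem length_Tsorted {c : ℕ} (x : Fin c → ℕ) : (Tsorted x).length = c := by
  simp [Tsorted, Tlist]

/-- A sorted list containing an element below every entry of a nonempty list precedes that
list in the alternating lexicographic order. -/
theorem altLt_of_mem_of_forall_lt {α : Type*} [LinearOrder α] {l m : List α} {p : α}
    (hl : l.Pairwise (· ≤ ·)) (hp : p ∈ l) (hm : m ≠ []) (hlt : ∀ q ∈ m, p < q) :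
    altLt l m := by
  cases l with
  | nil => simp at hp
  | cons a as =>
    cases m with
    | nil => exact absurd rfl hm
    | cons b bs =>
      have hap : a ≤ p := by
        rcases List.mem_cons.1 hp with h | h
        · exact h.ge
        · exact List.rel_of_pairwise_cons hl h
      have hab : a < b := hap.trans_lt (hlt b List.mem_cons_self)
      simp [altLt, altB, hab, hab.ne]

/-- For tuples of positive integers: if `τ` contains the value 1 in one of its
first `k` components and `τ'` does not contain the value 1 in any of its first
`k` components, then `τ <_VORTEX τ'`. -/
theorem stmt14 {c : ℕ} (k : ℕ) (hk1 : 1 ≤ k) (hkc : k ≤ c)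
    (τ τ' : Fin c → ℕ) (hτ : ∀ i, 1 ≤ τ i) (hτ' : ∀ i, 1 ≤ τ' i)
    (h1 : ∃ i : Fin c, i.1 < k ∧ τ i = 1)
    (h2 : ∀ i : Fin c, i.1 < k → τ' i ≠ 1) :
    vortexLt τ τ' := by
  obtain ⟨i, hik, hi⟩ := h1
  refine altLt_of_mem_of_forall_lt (Tsorted_pairwise τ) (mem_Tsorted.2 ⟨i, rfl⟩) ?_ ?_
  · rw [← List.length_pos_iff, length_Tsorted]
    omega
  · intro q hq
    obtain ⟨j, rfl⟩ := mem_Tsorted.1 hq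
    have hj := hτ' j
    have hj' := h2 j
    rw [Prod.Lex.toLex_lt_toLex]
    dsimp only
    omega
end
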